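/- Let 𝒱 and 𝒰 be nonempty finite sets, p : 𝒱×𝒰 → ℝ a probability mass function (p ≥ 0, ∑ p = 1) whose marginal p_U(u) = ∑_{v} p(v,u) is strictly positive for every u, and set p_{V|U}(v|u) := p(v,u)/p_U(u). Let {ρ^{v,u}} be density matrices on ℂ^d, and let σ^u := ∑_{v} p_{V|U}(v|u) ρ^{v,u}; assume each σ^u is positive definite. Fix α ∈ (0, 1/2), an integer L ≥ 1, and let ν₂ := max_{u} (number of distinct eigenvalues of σ^u). For u ∈ 𝒰 and a tuple v = (v_1,…,v_L) ∈ 𝒱^L, set τ_{u,v} := (1/L) ∑_{ℓ=1}^L ρ^{v_ℓ,u}. Then the expectation over u drawn from p_U and v_1,…,v_L drawn i.i.d. from p_{V|U}(·|u) satisfies ∑_{u∈𝒰} p_U(u) ∑_{v∈𝒱^L} (∏_{ℓ=1}^L p_{V|U}(v_ℓ|u)) · D̃_{1+α}(τ_{u,v} ‖ σ^u) ≤ (1/(α·ln 2)) · (ν₂^α / L^α) · K, where K := ∑_{(v,u)∈𝒱×𝒰} p(v,u) · Tr[((σ^u)^{−α/(2(1+α))} ρ^{v,u} (σ^u)^{−α/(2(1+α))})^{1+α}].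 (In the paper L = 2^{R_S} and K = 2^{α D̃_{1+α}(ρ_{VUS} ‖ ρ_{V−U−S})} for the associated classical–quantum states; this is Lemma 1.) -/

import Mathlib

open Matrix BigOperators
open scoped ComplexOrder

noncomputable section

variable {n : Type*} [Fintype n] [DecidableEq n]

/-- Real power with the convention `0 ^ r = 0`. -/
def rpow0 (x r : ℝ) : ℝ := if x = 0 then 0 else Real.rpow x r

/-- Matrix power by the spectral functional calculus (with `0 ^ r = 0` on the kernel),
for Hermitian matrices; junk value `0` otherwise. -/
def matPow (M : Matrix n n ℂ) (r : ℝ) : Matrix n n ℂ :=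
  if h : M.IsHermitian then
    (h.eigenvectorUnitary : Matrix n n ℂ) *
      Matrix.diagonal (fun i => (rpow0 (h.eigenvalues i) r : ℂ)) *
      star (h.eigenvectorUnitary : Matrix n n ℂ)
  else 0

/-- A density matrix: positive semidefinite with unit trace. -/
def IsDensityMatrix (M : Matrix n n ℂ) : Prop := M.PosSemidef ∧ M.trace = 1

/-- Number of distinct eigenvalues of a Hermitian matrix (junk value `0` otherwise). -/
def nEig (M : Matrix n n ℂ) : ℕ :=
  if h : M.IsHermitian then (Finset.univ.image h.eigenvalues).card else 0

/-- The spectral projection of a Hermitian matrix onto the eigenspace of `t`. -/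
def spectralProj (M : Matrix n n ℂ) (h : M.IsHermitian) (t : ℝ) : Matrix n n ℂ :=
  (h.eigenvectorUnitary : Matrix n n ℂ) *
    Matrix.diagonal (fun i => if h.eigenvalues i = t then (1 : ℂ) else 0) *
    star (h.eigenvectorUnitary : Matrix n n ℂ)

/-- The pinching map with respect to a Hermitian matrix `A`:
`ℰ_A(B) = ∑_λ P_λ B P_λ` over the distinct eigenvalues `λ` of `A`. -/
def pinch (A B : Matrix n n ℂ) : Matrix n n ℂ :=
  if h : A.IsHermitian then
    ∑ t ∈ Finset.univ.image h.eigenvalues,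
      spectralProj A h t * B * spectralProj A h t
  else B

/-- The spectral projection of a Hermitian matrix onto its nonnegative eigenvalues,
`Π = ∑_{λ ≥ 0} P_λ` (junk value `0` for non-Hermitian matrices). -/
def posProj (M : Matrix n n ℂ) : Matrix n n ℂ :=
  if h : M.IsHermitian then
    (h.eigenvectorUnitary : Matrix n n ℂ) *
      Matrix.diagonal (fun i => if 0 ≤ h.eigenvalues i then (1 : ℂ) else 0) *
      star (h.eigenvectorUnitary : Matrix n n ℂ)
  else 0

/-- The sandwiched Rényi divergence
`D̃_α(ρ‖σ) = (1/(α−1)) log₂ Tr[(σ^{(1−α)/(2α)} ρ σ^{(1−α)/(2α)})^α]`. -/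
def sandwichedRenyi (α : ℝ) (ρ σ : Matrix n n ℂ) : ℝ :=
  (1 / (α - 1)) *
    Real.logb 2
      ((matPow (matPow σ ((1 - α) / (2 * α)) * ρ * matPow σ ((1 - α) / (2 * α))) α).trace.re)

/-- Fidelity `F(ρ,σ) = Tr[(σ^{1/2} ρ σ^{1/2})^{1/2}]`. -/
def fidelity (ρ σ : Matrix n n ℂ) : ℝ :=
  (matPow (matPow σ (1/2) * ρ * matPow σ (1/2)) (1/2)).trace.re

/-- Purified distance `P(ρ,σ) = √(1 − F(ρ,σ)²)`. -/
def purifiedDist (ρ σ : Matrix n n ℂ) : ℝ :=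
  Real.sqrt (1 - (fidelity ρ σ) ^ 2)

/-- Base-two matrix logarithm by spectral functional calculus (`0 ↦ 0` on the kernel). -/
def matLog2 (M : Matrix n n ℂ) : Matrix n n ℂ :=
  if h : M.IsHermitian then
    (h.eigenvectorUnitary : Matrix n n ℂ) *
      Matrix.diagonal (fun i => (Real.logb 2 (h.eigenvalues i) : ℂ)) *
      star (h.eigenvectorUnitary : Matrix n n ℂ)
  else 0

/-- Quantum relative entropy `D(ρ‖σ) = Tr[ρ (log₂ ρ − log₂ σ)]`. -/
def relEntropy (ρ σ : Matrix n n ℂ) : ℝ :=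
  (ρ * (matLog2 ρ - matLog2 σ)).trace.re


end

section OperatorPowers

open scoped NNReal

variable {A : Type*} [CStarAlgebra A] [PartialOrder A] [StarOrderedRing A]

theorem rpow_add_of_pos {a : A} {x y : ℝ} (hx : 0 < x) (hy : 0 < y) :
    a ^ (x + y) = a ^ x * a ^ y := by
  lift x to ℝ≥0 using hx.le
  lift y to ℝ≥0 using hy.le
  have hx' : 0 < x := by exact_mod_cast hx
  have hy' : 0 < y := by exact_mod_cast hy
  rw [← CFC.nnrpow_eq_rpow hx', ← CFC.nnrpow_eq_rpow hy', ← NNReal.coe_add,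
    ← CFC.nnrpow_eq_rpow (add_pos hx' hy'), CFC.nnrpow_add hx' hy']

theorem commute_rpow {a b : A} (h : Commute a b) (r : ℝ) : Commute (a ^ r) b := by
  rw [CFC.rpow_def]
  exact h.cfc_nnreal _

theorem smul_rpow {a : A} (ha : 0 ≤ a) {c r : ℝ} (hc : 0 ≤ c) (hr : 0 ≤ r) :
    (c • a) ^ r = c ^ r • a ^ r := by
  have hcont : Continuous fun x : ℝ => x ^ r := Real.continuous_rpow_const hr
  rw [CFC.rpow_eq_cfc_real (smul_nonneg hc ha), CFC.rpow_eq_cfc_real ha,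
    ← cfc_smul_id (R := ℝ) c a, ← cfc_comp' (fun x : ℝ => x ^ r) (fun x => c • x) a
      (by fun_prop) (by fun_prop), ← cfc_smul (c ^ r) _ a (by fun_prop)]
  refine cfc_congr fun x hx => ?_
  have hx0 : 0 ≤ x := spectrum_nonneg_of_nonneg ha hx
  simp [Real.mul_rpow hc hx0]

/-- If `a ≤ z` commute, then `a z^(r-1) ≤ a^r`, written in symmetric form. -/
theorem conj_rpow_le_rpow_of_commute {a z : A} (ha : 0 ≤ a) (haz : a ≤ z)
    (hz : IsStrictlyPositive z) (h : Commute a z) {r : ℝ} (hr : r ∈ Set.Ioo (0 : ℝ) 1) :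
    z ^ ((r - 1) / 2) * a * z ^ ((r - 1) / 2) ≤ a ^ r := by
  obtain ⟨hr0, hr1⟩ := hr
  set c := z ^ ((r - 1) / 2) with hc
  set d := a ^ (r / 2) with hd
  have hcd : Commute c d := commute_rpow (commute_rpow h _).symm _
  have hle : c * a ^ (1 - r) * c ≤ 1 := by
    calc c * a ^ (1 - r) * c ≤ c * z ^ (1 - r) * c :=
          conjugate_le_conjugate_of_nonneg
            (CFC.rpow_le_rpow ⟨by linarith, by linarith⟩ haz) CFC.rpow_nonneg
      _ = 1 := by
          rw [hc, ← CFC.rpow_add hz.isUnit, ← CFC.rpow_add hz.isUnit]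
          rw [show (r - 1) / 2 + (1 - r) + (r - 1) / 2 = 0 by ring, CFC.rpow_zero z hz.nonneg]
  have hmid : d * a ^ (1 - r) * d = a := by
    rw [hd, ← rpow_add_of_pos (by linarith) (by linarith),
      ← rpow_add_of_pos (by linarith) (by linarith)]
    rw [show r / 2 + (1 - r) + r / 2 = 1 by ring, CFC.rpow_one a ha]
  calc c * a * c = d * (c * a ^ (1 - r) * c) * d := by
        conv_lhs => rw [← hmid]
        simp only [mul_assoc]
        rw [← hcd.eq]
        simp only [← mul_assoc]
        rw [hcd.eq]
    _ ≤ d * 1 * d := conjugate_le_conjugate_of_nonneg hle CFC.rpow_nonneg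
    _ = a ^ r := by
        rw [mul_one, hd, ← rpow_add_of_pos (by linarith) (by linarith), add_halves]

theorem add_rpow_le_of_commute {a b : A} (ha : 0 ≤ a) (hb : 0 ≤ b)
    (hab : IsStrictlyPositive (a + b)) (h : Commute a b) {r : ℝ}
    (hr : r ∈ Set.Ioo (0 : ℝ) 1) : (a + b) ^ r ≤ a ^ r + b ^ r := by
  have key : (a + b) ^ r = (a + b) ^ ((r - 1) / 2) * a * (a + b) ^ ((r - 1) / 2) +
      (a + b) ^ ((r - 1) / 2) * b * (a + b) ^ ((r - 1) / 2) := by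
    rw [← add_mul, ← mul_add]
    conv_rhs => enter [1, 2]; rw [← CFC.rpow_one (a + b) hab.nonneg]
    rw [← CFC.rpow_add hab.isUnit, ← CFC.rpow_add hab.isUnit]
    congr 1
    ring
  rw [key]
  exact add_le_add
    (conj_rpow_le_rpow_of_commute ha (le_add_of_nonneg_right hb) hab
      ((Commute.refl a).add_right h) hr)
    (conj_rpow_le_rpow_of_commute hb (le_add_of_nonneg_left ha) hab
      (h.symm.add_right (Commute.refl b)) hr)

end OperatorPowers

section Pinching

variable {A : Type*} [Ring A] [StarRing A] [PartialOrder A] [StarOrderedRing A]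
  [Module ℝ A] [PosSMulMono ℝ A]

theorem le_card_smul_pinching {ι : Type*} {s : Finset ι} {P : ι → A}
    (hP : ∀ i ∈ s, IsSelfAdjoint (P i)) (hsum : ∑ i ∈ s, P i = 1) {x : A} (hx : 0 ≤ x) :
    x ≤ (s.card : ℝ) • ∑ i ∈ s, P i * x * P i := by
  have hpos : 0 ≤ ∑ i ∈ s, ∑ j ∈ s, (P i - P j) * x * (P i - P j) :=
    Finset.sum_nonneg fun i hi => Finset.sum_nonneg fun j hj =>
      ((hP i hi).sub (hP j hj)).conjugate_nonneg hx
  have hexp : ∑ i ∈ s, ∑ j ∈ s, (P i - P j) * x * (P i - P j) =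
      (2 : ℝ) • ((s.card : ℝ) • ∑ i ∈ s, P i * x * P i - x) := by
    have h1 : ∑ i ∈ s, ∑ j ∈ s, P i * x * P j = x := by
      simp_rw [← Finset.mul_sum, ← Finset.sum_mul, hsum, one_mul, mul_one]
    have h2 : ∑ i ∈ s, ∑ j ∈ s, P j * x * P i = x := by rw [Finset.sum_comm, h1]
    simp only [sub_mul, mul_sub, Finset.sum_sub_distrib, h1, h2, Finset.sum_const,
      ← Finset.smul_sum]
    rw [two_smul, Nat.cast_smul_eq_nsmul]
    abel
  rw [hexp] at hpos
  have := smul_nonneg (show (0 : ℝ) ≤ 2⁻¹ by norm_num) hpos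
  rw [smul_smul, inv_mul_cancel₀ two_ne_zero, one_smul] at this
  exact sub_nonneg.mp this

end Pinching

section TraceInequalities

open scoped MatrixOrder Matrix.Norms.L2Operator

variable {n : Type*} [Fintype n] [DecidableEq n]

theorem matPow_eq_rpow {M : Matrix n n ℂ} (hM : 0 ≤ M) {r : ℝ} (hr : r ≠ 0) :
    matPow M r = M ^ r := by
  have hH : M.IsHermitian := (Matrix.nonneg_iff_posSemidef.mp hM).1
  rw [CFC.rpow_eq_cfc_real hM, hH.cfc_eq, matPow, dif_pos hH, IsHermitian.cfc,
    Unitary.conjStarAlgAut_apply]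
  congr 3
  funext i
  simp only [rpow0, Function.comp]
  split_ifs with h
  · simp [h, Real.zero_rpow hr]
  · rfl

theorem trace_re_mul_nonneg {X Y : Matrix n n ℂ} (hX : 0 ≤ X) (hY : 0 ≤ Y) :
    0 ≤ (X * Y).trace.re := by
  obtain ⟨B, rfl⟩ := CStarAlgebra.nonneg_iff_eq_star_mul_self.mp hX
  have h := (Matrix.nonneg_iff_posSemidef.mp (star_right_conjugate_nonneg hY B)).trace_nonneg
  rw [mul_assoc, Matrix.trace_mul_comm]
  exact (Complex.le_def.mp h).1

theorem trace_re_mul_le_mul {X Y Z : Matrix n n ℂ} (hX : 0 ≤ X) (hYZ : Y ≤ Z) :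
    (X * Y).trace.re ≤ (X * Z).trace.re := by
  have h := trace_re_mul_nonneg hX (sub_nonneg.mpr hYZ)
  rw [mul_sub, Matrix.trace_sub, Complex.sub_re] at h
  linarith

theorem trace_re_cfc_mul_cfc {X Y : Matrix n n ℂ} (hX : X.IsHermitian) (hY : Y.IsHermitian)
    (f g : ℝ → ℝ) :
    (cfc f X * cfc g Y).trace.re = ∑ i, ∑ j, f (hX.eigenvalues i) * g (hY.eigenvalues j) *
      Complex.normSq ((star (hX.eigenvectorUnitary : Matrix n n ℂ) *
        (hY.eigenvectorUnitary : Matrix n n ℂ)) i j) := by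
  set W := star (hX.eigenvectorUnitary : Matrix n n ℂ) *
    (hY.eigenvectorUnitary : Matrix n n ℂ) with hW
  have hWs : star (hY.eigenvectorUnitary : Matrix n n ℂ) *
      (hX.eigenvectorUnitary : Matrix n n ℂ) = star W := by simp [hW]
  rw [hX.cfc_eq, hY.cfc_eq, IsHermitian.cfc, IsHermitian.cfc, Unitary.conjStarAlgAut_apply,
    Unitary.conjStarAlgAut_apply]
  rw [mul_assoc, mul_assoc, Matrix.trace_mul_comm]
  simp only [mul_assoc]
  rw [hWs]
  rw [← mul_assoc (star _) _ (_ * _), ← hW]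
  simp only [Matrix.trace, Matrix.diag, Matrix.diagonal_mul, Complex.re_sum]
  refine Finset.sum_congr rfl fun i _ => ?_
  rw [Matrix.mul_apply, Finset.mul_sum, Complex.re_sum]
  refine Finset.sum_congr rfl fun j _ => ?_
  rw [Matrix.diagonal_mul, Matrix.star_apply]
  have : W i j * star (W i j) = (Complex.normSq (W i j) : ℂ) := Complex.mul_conj _
  simp only [Function.comp_apply, Complex.coe_algebraMap]
  rw [mul_left_comm (W i j), this]
  simp [← Complex.ofReal_mul]

/-- Young's inequality for the trace. -/
theorem trace_re_mul_rpow_le {X Y : Matrix n n ℂ} (hX : 0 ≤ X) (hY : 0 ≤ Y) {α : ℝ}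
    (hα : 0 < α) :
    (X * Y ^ α).trace.re ≤
      ((X ^ (1 + α)).trace.re + α * (Y ^ (1 + α)).trace.re) / (1 + α) := by
  have hX' := Matrix.nonneg_iff_posSemidef.mp hX
  have hY' := Matrix.nonneg_iff_posSemidef.mp hY
  have e1 : X * Y ^ α = cfc (fun x : ℝ => x) X * cfc (fun y : ℝ => y ^ α) Y := by
    rw [cfc_id' ℝ X hX'.1.isSelfAdjoint, CFC.rpow_eq_cfc_real hY]
  have e2 : X ^ (1 + α) = cfc (fun x : ℝ => x ^ (1 + α)) X * cfc (fun _ : ℝ => (1 : ℝ)) Y := by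
    rw [cfc_const_one ℝ Y hY'.1.isSelfAdjoint, CFC.rpow_eq_cfc_real hX, mul_one]
  have e3 : Y ^ (1 + α) = cfc (fun _ : ℝ => (1 : ℝ)) X * cfc (fun x : ℝ => x ^ (1 + α)) Y := by
    rw [cfc_const_one ℝ X hX'.1.isSelfAdjoint, CFC.rpow_eq_cfc_real hY, one_mul]
  rw [e1, e2, e3, trace_re_cfc_mul_cfc hX'.1 hY'.1, trace_re_cfc_mul_cfc hX'.1 hY'.1,
    trace_re_cfc_mul_cfc hX'.1 hY'.1]
  simp only [Finset.mul_sum, ← Finset.sum_add_distrib, Finset.sum_div]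
  refine Finset.sum_le_sum fun i _ => Finset.sum_le_sum fun j _ => ?_
  have hx := hX'.eigenvalues_nonneg i
  have hy := hY'.eigenvalues_nonneg j
  have hconj : (1 + α).HolderConjugate ((1 + α) / α) := by
    rw [Real.holderConjugate_iff]
    refine ⟨by linarith, ?_⟩
    field_simp
  have hyoung := Real.young_inequality_of_nonneg hx (Real.rpow_nonneg hy α) hconj
  rw [← Real.rpow_mul hy, mul_div_cancel₀ _ hα.ne'] at hyoung
  have := mul_le_mul_of_nonneg_right hyoung (Complex.normSq_nonneg
    ((star (hX'.1.eigenvectorUnitary : Matrix n n ℂ) *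
        (hY'.1.eigenvectorUnitary : Matrix n n ℂ)) i j))
  refine this.trans (le_of_eq ?_)
  field_simp

theorem rpow_one_add {X : Matrix n n ℂ} (hX : 0 ≤ X) {α : ℝ} (hα : 0 < α) :
    X ^ (1 + α) = X * X ^ α := by
  rw [rpow_add_of_pos one_pos hα, CFC.rpow_one X hX]

theorem trace_re_rpow_one_add_le {X Y : Matrix n n ℂ} (hX : 0 ≤ X) (hY : 0 ≤ Y) {α : ℝ}
    (hα : 0 < α) (h : (X * Y ^ α).trace = (Y * Y ^ α).trace) :
    (Y ^ (1 + α)).trace.re ≤ (X ^ (1 + α)).trace.re := by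
  have hyoung := trace_re_mul_rpow_le hX hY hα
  rw [h, ← rpow_one_add hY hα, le_div_iff₀ (by linarith)] at hyoung
  linarith

theorem trace_re_rpow_pos {X : Matrix n n ℂ} (hX : 0 ≤ X) (hX0 : X ≠ 0) {r : ℝ} (hr : 0 < r) :
    0 < (X ^ r).trace.re := by
  have hpow : (X ^ r).PosSemidef := Matrix.nonneg_iff_posSemidef.mp CFC.rpow_nonneg
  obtain ⟨hre, him⟩ := Complex.le_def.mp hpow.trace_nonneg
  refine lt_of_le_of_ne hre fun h0 => hX0 ?_
  have hzero : X ^ r = 0 := hpow.trace_eq_zero_iff.mp (Complex.ext h0.symm him.symm)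
  have hinv := CFC.rpow_rpow_of_exponent_nonneg X r r⁻¹ hr.le (inv_nonneg.mpr hr.le) hX
  rw [mul_inv_cancel₀ hr.ne', CFC.rpow_one X hX, hzero] at hinv
  rw [← hinv]
  exact CFC.zero_rpow (inv_ne_zero hr.ne')

theorem trace_mul_eq_trace_pinching_mul {ι : Type*} {s : Finset ι} {P : ι → Matrix n n ℂ}
    (hidem : ∀ i ∈ s, P i * P i = P i) (hsum : ∑ i ∈ s, P i = 1) (X : Matrix n n ℂ)
    {W : Matrix n n ℂ} (hW : ∀ i ∈ s, Commute (P i) W) :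
    (X * W).trace = ((∑ i ∈ s, P i * X * P i) * W).trace := by
  rw [Finset.sum_mul, Matrix.trace_sum]
  calc (X * W).trace = ∑ i ∈ s, (X * (P i * W)).trace := by
        rw [← Matrix.trace_sum, ← Finset.mul_sum, ← Finset.sum_mul, hsum, one_mul]
    _ = ∑ i ∈ s, (P i * X * P i * W).trace := by
        refine Finset.sum_congr rfl fun i hi => ?_
        rw [mul_assoc, mul_assoc, Matrix.trace_mul_comm (P i), mul_assoc, mul_assoc,
          ← (hW i hi).eq, ← mul_assoc (P i) (P i) W, hidem i hi]

theorem commute_pinching {ι : Type*} {s : Finset ι} {P : ι → Matrix n n ℂ}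
    (hidem : ∀ i ∈ s, P i * P i = P i)
    (horth : ∀ i ∈ s, ∀ j ∈ s, i ≠ j → P i * P j = 0) (X : Matrix n n ℂ) {i : ι} (hi : i ∈ s) :
    Commute (P i) (∑ j ∈ s, P j * X * P j) := by
  rw [Commute, SemiconjBy, Finset.mul_sum, Finset.sum_mul, Finset.sum_eq_single_of_mem i hi,
    Finset.sum_eq_single_of_mem i hi]
  · rw [mul_assoc, mul_assoc, mul_assoc, hidem i hi, ← mul_assoc, hidem i hi]
  · intro j hj hji
    rw [mul_assoc, horth j hj i hi hji, mul_zero]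
  · intro j hj hji
    rw [← mul_assoc, ← mul_assoc, horth i hi j hj hji.symm, zero_mul, zero_mul]

theorem trace_re_mul_add_rpow_le {ι : Type*} {s : Finset ι} {P : ι → Matrix n n ℂ}
    (hP : ∀ i ∈ s, IsSelfAdjoint (P i)) (hidem : ∀ i ∈ s, P i * P i = P i)
    (horth : ∀ i ∈ s, ∀ j ∈ s, i ≠ j → P i * P j = 0) (hsum : ∑ i ∈ s, P i = 1)
    {X T : Matrix n n ℂ} (hX : 0 ≤ X) (hT : IsStrictlyPositive T) {t : ι → ℝ}
    (hPT : ∀ i ∈ s, P i * T = t i • P i) {α : ℝ} (hα : α ∈ Set.Ioo (0 : ℝ) 1) {a b : ℝ}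
    (ha : 0 ≤ a) (hb : b ≤ 1) :
    (X * (a • X + b • T) ^ α).trace.re ≤
      (a * s.card) ^ α * (X ^ (1 + α)).trace.re + (X * T ^ α).trace.re := by
  set E := ∑ i ∈ s, P i * X * P i with hE
  have hE0 : 0 ≤ E := Finset.sum_nonneg fun i hi => (hP i hi).conjugate_nonneg hX
  have hc0 : 0 ≤ a * s.card := mul_nonneg ha (Nat.cast_nonneg _)
  have hTP : ∀ i ∈ s, T * P i = t i • P i := fun i hi => by
    have h := congrArg star (hPT i hi)
    rwa [star_mul, star_smul, (hP i hi).star_eq,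
      (IsSelfAdjoint.of_nonneg hT.nonneg).star_eq, star_trivial] at h
  have hET : Commute E T := Commute.sum_left _ _ _ fun i hi => by
    rw [Commute, SemiconjBy, mul_assoc, hPT i hi, ← mul_assoc, ← mul_assoc, hTP i hi]
    simp
  have hmono : a • X + b • T ≤ (a * s.card) • E + T := by
    rw [← smul_smul]
    refine add_le_add (smul_le_smul_of_nonneg_left (le_card_smul_pinching hP hsum hX) ha) ?_
    simpa using smul_le_smul_of_nonneg_right hb hT.nonneg
  have hsub : ((a * s.card) • E + T) ^ α ≤ (a * s.card) ^ α • E ^ α + T ^ α := by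
    rw [← smul_rpow hE0 hc0 hα.1.le]
    exact add_rpow_le_of_commute (smul_nonneg hc0 hE0) hT.nonneg
      (hT.nonneg_add (smul_nonneg hc0 hE0)) (hET.smul_left _) hα
  have hXE : (X * E ^ α).trace = (E * E ^ α).trace :=
    trace_mul_eq_trace_pinching_mul hidem hsum X fun i hi =>
      (commute_rpow (commute_pinching hidem horth X hi).symm α).symm
  have hpinch := trace_re_rpow_one_add_le hX hE0 hα.1 hXE
  calc (X * (a • X + b • T) ^ α).trace.re
      ≤ (X * ((a * s.card) ^ α • E ^ α + T ^ α)).trace.re :=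
        trace_re_mul_le_mul hX ((CFC.rpow_le_rpow ⟨hα.1.le, hα.2.le⟩ hmono).trans hsub)
    _ = (a * s.card) ^ α * (E ^ (1 + α)).trace.re + (X * T ^ α).trace.re := by
        rw [mul_add, mul_smul_comm, Matrix.trace_add, Matrix.trace_smul, hXE,
          ← rpow_one_add hE0 hα.1]
        simp
    _ ≤ _ := by gcongr

end TraceInequalities

section RandomCodebook

theorem sum_eq_sum_insertNth {V M : Type*} [Fintype V] [AddCommMonoid M] {m : ℕ}
    (F : (Fin (m + 1) → V) → M) (l : Fin (m + 1)) :
    ∑ v, F v = ∑ w, ∑ v : Fin m → V, F (l.insertNth w v) := by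
  rw [← Fintype.sum_prod_type' (fun w (v : Fin m → V) => F (l.insertNth w v))]
  exact (Fintype.sum_equiv (Fin.insertNthEquiv (fun _ => V) l) _ _ fun _ => rfl).symm

theorem sum_prod_eq_one {V : Type*} [Fintype V] {q : V → ℝ} (hq : ∑ v, q v = 1) (m : ℕ) :
    ∑ v : Fin m → V, ∏ k, q (v k) = 1 := by
  classical
  rw [← Fintype.piFinset_univ, ← Finset.prod_univ_sum]
  simp [hq]

theorem sum_prod_smul_apply {V M : Type*} [Fintype V] [AddCommGroup M] [Module ℝ M]
    {q : V → ℝ} (hq : ∑ v, q v = 1) {m : ℕ} (f : V → M) (l : Fin m) :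
    ∑ v : Fin m → V, (∏ k, q (v k)) • f (v l) = ∑ w, q w • f w := by
  obtain _ | m := m
  · exact l.elim0
  · rw [sum_eq_sum_insertNth _ l]
    refine Finset.sum_congr rfl fun w _ => ?_
    simp only [Fin.prod_univ_succAbove _ l, Fin.insertNth_apply_same,
      Fin.insertNth_apply_succAbove]
    rw [← Finset.sum_smul, ← Finset.mul_sum, sum_prod_eq_one hq, mul_one]

open scoped MatrixOrder Matrix.Norms.L2Operator

variable {n : Type*} [Fintype n] [DecidableEq n]

theorem sum_prod_trace_re_average_le {V ι : Type*} [Fintype V] {q : V → ℝ}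
    (hq0 : ∀ v, 0 ≤ q v) (hq : ∑ v, q v = 1) {s : Finset ι} {P : ι → Matrix n n ℂ}
    (hP : ∀ i ∈ s, IsSelfAdjoint (P i)) (hidem : ∀ i ∈ s, P i * P i = P i)
    (horth : ∀ i ∈ s, ∀ j ∈ s, i ≠ j → P i * P j = 0) (hsum : ∑ i ∈ s, P i = 1)
    {X : V → Matrix n n ℂ} {T : Matrix n n ℂ} (hX : ∀ v, 0 ≤ X v)
    (hXT : ∑ v, q v • X v = T) (hT : IsStrictlyPositive T) {t : ι → ℝ}
    (hPT : ∀ i ∈ s, P i * T = t i • P i) {α : ℝ} (hα : α ∈ Set.Ioo (0 : ℝ) 1)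
    (htr : ∀ v, (X v * T ^ α).trace.re = 1) {L : ℕ} (hL : 1 ≤ L) :
    ∑ v : Fin L → V, (∏ k, q (v k)) *
        ((((1 / (L : ℝ)) • ∑ k, X (v k)) ^ (1 + α)).trace.re) ≤
      1 + ((s.card : ℝ) / L) ^ α * ∑ v, q v * (X v ^ (1 + α)).trace.re := by
  obtain ⟨m, rfl⟩ : ∃ m, L = m + 1 := ⟨L - 1, by omega⟩
  set c : ℝ := 1 / ((m + 1 : ℕ) : ℝ) with hc
  have hc0 : 0 ≤ c := by positivity
  have hcm : c * ((m + 1 : ℕ) : ℝ) = 1 := by rw [hc]; field_simp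
  set B := 1 + ((s.card : ℝ) / (m + 1 : ℕ)) ^ α * ∑ v, q v * (X v ^ (1 + α)).trace.re with hB
  have hpos : ∀ {k : ℕ} (v : Fin k → V), 0 ≤ ∑ j, X (v j) := fun v =>
    Finset.sum_nonneg fun j _ => hX (v j)
  have hletter : ∀ w, ∑ v : Fin m → V, (∏ k, q (v k)) *
      (X w * (c • (X w + ∑ k, X (v k))) ^ α).trace.re ≤
      1 + ((s.card : ℝ) / (m + 1 : ℕ)) ^ α * (X w ^ (1 + α)).trace.re := by
    intro w
    have hmean : ∑ v : Fin m → V, (∏ k, q (v k)) • c • (X w + ∑ k, X (v k)) =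
        c • X w + (c * m) • T := by
      simp_rw [smul_add, Finset.sum_add_distrib, ← Finset.sum_smul]
      rw [sum_prod_eq_one hq, one_smul]
      simp_rw [Finset.smul_sum]
      rw [Finset.sum_comm]
      simp_rw [sum_prod_smul_apply hq (fun v => c • X v), smul_comm _ c, ← Finset.smul_sum, hXT]
      simp [← Nat.cast_smul_eq_nsmul ℝ, smul_smul, mul_comm]
    have hjensen := (CFC.concaveOn_rpow (A := Matrix n n ℂ) ⟨hα.1.le, hα.2.le⟩).le_map_sum
      (t := Finset.univ) (w := fun v : Fin m → V => ∏ k, q (v k))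
      (p := fun v => c • (X w + ∑ k, X (v k)))
      (fun v _ => Finset.prod_nonneg fun k _ => hq0 _) (sum_prod_eq_one hq m)
      (fun v _ => smul_nonneg hc0 (add_nonneg (hX w) (hpos v)))
    simp only [hmean] at hjensen
    calc ∑ v : Fin m → V, (∏ k, q (v k)) * (X w * (c • (X w + ∑ k, X (v k))) ^ α).trace.re
        = (X w * ∑ v : Fin m → V, (∏ k, q (v k)) •
            (c • (X w + ∑ k, X (v k))) ^ α).trace.re := by
          simp only [Finset.mul_sum, mul_smul_comm, Matrix.trace_sum, Matrix.trace_smul,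
            Complex.re_sum, Complex.real_smul, Complex.re_ofReal_mul]
      _ ≤ (X w * (c • X w + (c * m) • T) ^ α).trace.re := trace_re_mul_le_mul (hX w) hjensen
      _ ≤ (c * s.card) ^ α * (X w ^ (1 + α)).trace.re + (X w * T ^ α).trace.re :=
          trace_re_mul_add_rpow_le hP hidem horth hsum (hX w) hT hPT hα hc0 (by
            rw [← hcm]; gcongr; simp)
      _ = _ := by rw [htr, add_comm, hc, one_div_mul_eq_div]
  have hcoord : ∀ l : Fin (m + 1), ∑ v : Fin (m + 1) → V, (∏ k, q (v k)) *
      (X (v l) * (c • ∑ k, X (v k)) ^ α).trace.re ≤ B := by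
    intro l
    rw [sum_eq_sum_insertNth _ l]
    simp only [Fin.prod_univ_succAbove _ l, Fin.sum_univ_succAbove _ l,
      Fin.insertNth_apply_same, Fin.insertNth_apply_succAbove, mul_assoc, ← Finset.mul_sum]
    calc _ ≤ ∑ w, q w * (1 + ((s.card : ℝ) / (m + 1 : ℕ)) ^ α * (X w ^ (1 + α)).trace.re) :=
          Finset.sum_le_sum fun w _ => mul_le_mul_of_nonneg_left (hletter w) (hq0 w)
      _ = B := by
          simp only [mul_add, Finset.sum_add_distrib, mul_one, hq, hB, Finset.mul_sum]
          congr 1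
          exact Finset.sum_congr rfl fun w _ => mul_left_comm _ _ _
  calc _ = ∑ l, c * ∑ v : Fin (m + 1) → V, (∏ k, q (v k)) *
        (X (v l) * (c • ∑ k, X (v k)) ^ α).trace.re := by
        simp only [Finset.mul_sum]
        rw [Finset.sum_comm]
        refine Finset.sum_congr rfl fun v _ => ?_
        rw [rpow_one_add (smul_nonneg hc0 (hpos v)) hα.1, smul_mul_assoc, Finset.sum_mul,
          Matrix.trace_smul, Matrix.trace_sum, Complex.real_smul, Complex.re_ofReal_mul,
          Complex.re_sum, Finset.mul_sum, Finset.mul_sum]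
        exact Finset.sum_congr rfl fun l _ => mul_left_comm _ _ _
    _ ≤ ∑ _l : Fin (m + 1), c * B :=
        Finset.sum_le_sum fun l _ => mul_le_mul_of_nonneg_left (hcoord l) hc0
    _ = B := by
        rw [Finset.sum_const, Finset.card_univ, Fintype.card_fin, nsmul_eq_mul, ← mul_assoc,
          mul_comm _ c, hcm, one_mul]

end RandomCodebook

section SpectralProjections

variable {n : Type*} [Fintype n] [DecidableEq n] {M : Matrix n n ℂ}

theorem spectralProj_eq_cfc (h : M.IsHermitian) (t : ℝ) :
    spectralProj M h t = h.cfc fun x => if x = t then 1 else 0 := by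
  rw [spectralProj, IsHermitian.cfc, Unitary.conjStarAlgAut_apply]
  congr 3
  funext i
  simp only [Function.comp]
  split_ifs <;> simp

theorem isHermitian_cfc_mul_cfc (h : M.IsHermitian) (f g : ℝ → ℝ) :
    h.cfc f * h.cfc g = h.cfc fun x => f x * g x := by
  rw [IsHermitian.cfc, IsHermitian.cfc, IsHermitian.cfc, ← map_mul, Matrix.diagonal_mul_diagonal]
  congr 2
  funext i
  simp

theorem isSelfAdjoint_spectralProj (h : M.IsHermitian) (t : ℝ) :
    IsSelfAdjoint (spectralProj M h t) := by
  rw [spectralProj_eq_cfc, ← h.cfc_eq]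
  exact cfc_predicate _ _

theorem spectralProj_mul_self (h : M.IsHermitian) (t : ℝ) :
    spectralProj M h t * spectralProj M h t = spectralProj M h t := by
  rw [spectralProj_eq_cfc, isHermitian_cfc_mul_cfc]
  congr 1
  funext x
  split_ifs <;> simp

theorem spectralProj_mul_of_ne (h : M.IsHermitian) {t t' : ℝ} (ht : t ≠ t') :
    spectralProj M h t * spectralProj M h t' = 0 := by
  rw [spectralProj_eq_cfc, spectralProj_eq_cfc, isHermitian_cfc_mul_cfc]
  have : (fun x : ℝ => (if x = t then (1 : ℝ) else 0) * if x = t' then 1 else 0) = 0 := by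
    funext x
    by_cases hx : x = t
    · simp [hx, ht]
    · simp [hx]
  rw [this, ← h.cfc_eq]
  exact cfc_zero ℝ M

theorem sum_spectralProj (h : M.IsHermitian) :
    ∑ t ∈ Finset.univ.image h.eigenvalues, spectralProj M h t = 1 := by
  simp only [spectralProj]
  rw [← Finset.sum_mul, ← Finset.mul_sum]
  have : ∑ t ∈ Finset.univ.image h.eigenvalues,
      Matrix.diagonal (fun i => if h.eigenvalues i = t then (1 : ℂ) else 0) = 1 := by
    ext i j
    rw [Matrix.sum_apply]
    by_cases hij : i = j
    · subst hij
      simp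
    · simp [hij]
  rw [this, mul_one]
  exact Unitary.coe_mul_star_self _

open scoped MatrixOrder Matrix.Norms.L2Operator

theorem spectralProj_mul_rpow (h : M.IsHermitian) (hM : 0 ≤ M) (t r : ℝ) :
    spectralProj M h t * M ^ r = t ^ r • spectralProj M h t := by
  rw [CFC.rpow_eq_cfc_real hM, h.cfc_eq, spectralProj_eq_cfc, isHermitian_cfc_mul_cfc]
  rw [IsHermitian.cfc, IsHermitian.cfc, Unitary.conjStarAlgAut_apply,
    Unitary.conjStarAlgAut_apply, ← smul_mul_assoc, ← mul_smul_comm, ← Matrix.diagonal_smul]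
  congr 3
  funext i
  by_cases hi : h.eigenvalues i = t <;> simp [hi]

end SpectralProjections

section SubcodebookAverage

open scoped MatrixOrder Matrix.Norms.L2Operator

variable {n : Type*} [Fintype n] [DecidableEq n]

/-- The bound for a single reference state `σ`, the mean of the states `ρ v`. -/
theorem sum_prod_sandwichedRenyi_le {V : Type*} [Fintype V] {q : V → ℝ}
    (hq0 : ∀ v, 0 ≤ q v) (hq : ∑ v, q v = 1) {ρ : V → Matrix n n ℂ}
    (hρ : ∀ v, IsDensityMatrix (ρ v)) {σ : Matrix n n ℂ} (hσ : σ = ∑ v, q v • ρ v)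
    (hσpd : σ.PosDef) {α : ℝ} (hα : α ∈ Set.Ioo (0 : ℝ) 1) {L : ℕ} (hL : 1 ≤ L) :
    ∑ v : Fin L → V, (∏ k, q (v k)) *
        sandwichedRenyi (1 + α) ((1 / (L : ℝ)) • ∑ k, ρ (v k)) σ ≤
      1 / (α * Real.log 2) * (((nEig σ : ℝ) / L) ^ α *
        ∑ v, q v * (matPow (matPow σ (-α / (2 * (1 + α))) * ρ v *
          matPow σ (-α / (2 * (1 + α)))) (1 + α)).trace.re) := by
  obtain ⟨hα0, hα1⟩ := hα
  have hα' : (0 : ℝ) < 1 + α := by linarith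
  have hσs : IsStrictlyPositive σ := Matrix.isStrictlyPositive_iff_posDef.mpr hσpd
  have hσ0 : 0 ≤ σ := hσs.nonneg
  have hσu : IsUnit σ := hσs.isUnit
  have hexp : (1 - (1 + α)) / (2 * (1 + α)) = -α / (2 * (1 + α)) := by ring
  have hexp0 : -α / (2 * (1 + α)) ≠ 0 := div_ne_zero (by linarith) (by linarith)
  set e : ℝ := -α / (2 * (1 + α)) with he
  set T := σ ^ (1 / (1 + α)) with hT
  set X : V → Matrix n n ℂ := fun v => σ ^ e * ρ v * σ ^ e with hX
  have hX0 : ∀ v, 0 ≤ X v := fun v =>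
    conjugate_nonneg_of_nonneg (hρ v).1.nonneg CFC.rpow_nonneg
  have hXT : ∑ v, q v • X v = T := by
    have : ∑ v, q v • X v = σ ^ e * σ * σ ^ e := by
      conv_rhs => enter [1, 2]; rw [hσ]
      simp [hX, Finset.mul_sum, Finset.sum_mul]
    rw [this]
    conv_lhs => enter [1, 2]; rw [← CFC.rpow_one σ hσ0]
    rw [← CFC.rpow_add hσu, ← CFC.rpow_add hσu, hT]
    congr 1
    rw [he]
    field_simp
    ring
  have hTs : IsStrictlyPositive T :=
    IsStrictlyPositive.iff_of_unital.mpr ⟨CFC.rpow_nonneg, hσu.cfcRpow _ hσ0⟩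
  have hTα : T ^ α = σ ^ (α / (1 + α)) := by
    rw [hT, CFC.rpow_rpow σ _ _ (by positivity) hσs]
    congr 1
    ring
  have htr : ∀ v, (X v * T ^ α).trace.re = 1 := by
    intro v
    have h1 : σ ^ e * σ ^ (α / (1 + α)) * σ ^ e = 1 := by
      rw [← CFC.rpow_add hσu, ← CFC.rpow_add hσu, ← CFC.rpow_zero σ hσ0]
      congr 1
      rw [he]
      field_simp
      ring
    rw [hTα, hX]
    simp only [mul_assoc]
    rw [Matrix.trace_mul_comm]
    simp only [mul_assoc] at h1 ⊢
    rw [h1, mul_one, (hρ v).2, Complex.one_re]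
  have hL0 : (0 : ℝ) < L := by exact_mod_cast hL
  have hmain := sum_prod_trace_re_average_le hq0 hq
    (s := Finset.univ.image hσpd.1.eigenvalues) (P := spectralProj σ hσpd.1)
    (fun t _ => isSelfAdjoint_spectralProj _ t) (fun t _ => spectralProj_mul_self _ t)
    (fun t _ t' _ h => spectralProj_mul_of_ne _ h) (sum_spectralProj _) hX0 hXT hTs
    (fun t _ => spectralProj_mul_rpow hσpd.1 hσ0 t _) ⟨hα0, hα1⟩ htr hL
  have hcard : (Finset.univ.image hσpd.1.eigenvalues).card = nEig σ := by
    rw [nEig, dif_pos hσpd.1]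
  rw [hcard] at hmain
  have hdiv : ∀ v : Fin L → V, sandwichedRenyi (1 + α) ((1 / (L : ℝ)) • ∑ k, ρ (v k)) σ ≤
      1 / (α * Real.log 2) * ((((1 / (L : ℝ)) • ∑ k, X (v k)) ^ (1 + α)).trace.re - 1) := by
    intro v
    have hA0 : 0 ≤ (1 / (L : ℝ)) • ∑ k, X (v k) :=
      smul_nonneg (by positivity) (Finset.sum_nonneg fun k _ => hX0 _)
    have hA : σ ^ e * ((1 / (L : ℝ)) • ∑ k, ρ (v k)) * σ ^ e =
        (1 / (L : ℝ)) • ∑ k, X (v k) := by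
      simp [hX, Finset.mul_sum, Finset.sum_mul]
    have hAne : (1 / (L : ℝ)) • ∑ k, X (v k) ≠ 0 := by
      intro h0
      have h1 : (((1 / (L : ℝ)) • ∑ k, X (v k)) * T ^ α).trace.re = 1 := by
        rw [smul_mul_assoc, Finset.sum_mul, Matrix.trace_smul, Matrix.trace_sum,
          Complex.real_smul, Complex.re_ofReal_mul, Complex.re_sum,
          Finset.sum_congr rfl fun k _ => htr (v k)]
        simp [hL0.ne']
      rw [h0] at h1
      simp at h1
    have hpos := trace_re_rpow_pos hA0 hAne hα'
    rw [sandwichedRenyi, hexp, matPow_eq_rpow hσ0 hexp0, hA, matPow_eq_rpow hA0 hα'.ne',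
      add_sub_cancel_left, Real.logb, one_div_mul_eq_div, div_div, mul_comm (Real.log 2),
      ← one_div_mul_eq_div]
    exact mul_le_mul_of_nonneg_left (Real.log_le_sub_one_of_pos hpos)
      (one_div_nonneg.mpr (mul_nonneg hα0.le (Real.log_nonneg one_le_two)))
  calc _ ≤ ∑ v : Fin L → V, (∏ k, q (v k)) * (1 / (α * Real.log 2) *
        ((((1 / (L : ℝ)) • ∑ k, X (v k)) ^ (1 + α)).trace.re - 1)) :=
        Finset.sum_le_sum fun v _ => mul_le_mul_of_nonneg_left (hdiv v)
          (Finset.prod_nonneg fun k _ => hq0 _)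
    _ = 1 / (α * Real.log 2) * (∑ v : Fin L → V, (∏ k, q (v k)) *
        (((1 / (L : ℝ)) • ∑ k, X (v k)) ^ (1 + α)).trace.re - 1) := by
        rw [← sum_prod_eq_one hq L, ← Finset.sum_sub_distrib, Finset.mul_sum]
        refine Finset.sum_congr rfl fun v _ => ?_
        rw [sum_prod_eq_one hq L]
        ring
    _ ≤ _ := by
        refine mul_le_mul_of_nonneg_left ?_
          (one_div_nonneg.mpr (mul_nonneg hα0.le (Real.log_nonneg one_le_two)))
        rw [matPow_eq_rpow hσ0 hexp0]
        have : ∀ v, matPow (σ ^ e * ρ v * σ ^ e) (1 + α) = X v ^ (1 + α) := fun v =>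
          matPow_eq_rpow (hX0 v) hα'.ne'
        simp only [this]
        linarith

theorem trace_re_matPow_nonneg {M : Matrix n n ℂ} (hM : 0 ≤ M) {r : ℝ} (hr : r ≠ 0) :
    0 ≤ (matPow M r).trace.re := by
  rw [matPow_eq_rpow hM hr]
  exact (Complex.le_def.mp
    (Matrix.nonneg_iff_posSemidef.mp (CFC.rpow_nonneg (a := M) (y := r))).trace_nonneg).1

theorem trace_re_matPow_sandwich_nonneg {ρ σ : Matrix n n ℂ} (hρ : ρ.PosSemidef)
    (hσ : σ.PosSemidef) {r s : ℝ} (hr : r ≠ 0) (hs : s ≠ 0) :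
    0 ≤ (matPow (matPow σ r * ρ * matPow σ r) s).trace.re := by
  refine trace_re_matPow_nonneg ?_ hs
  rw [matPow_eq_rpow hσ.nonneg hr]
  exact conjugate_nonneg_of_nonneg hρ.nonneg CFC.rpow_nonneg

end SubcodebookAverage

/-- subcodebook average bound (Lemma 1): the expected sandwiched Rényi
divergence between the subcodebook average state and `σ^u` is at most
`(1/(α ln 2)) · (ν₂^α / L^α) · 2^{α D̃_{1+α}(ρ_{VUS}‖ρ_{V−U−S})}`. -/
theorem subcodebook_average_divergence_bound
    {V U : Type*} [Fintype V] [DecidableEq V] [Nonempty V]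
    [Fintype U] [DecidableEq U] [Nonempty U]
    {n : Type*} [Fintype n] [DecidableEq n]
    (p : V × U → ℝ) (hp0 : ∀ vu, 0 ≤ p vu) (hp1 : ∑ vu : V × U, p vu = 1)
    (pU : U → ℝ) (hpU : ∀ u, pU u = ∑ v : V, p (v, u)) (hpUpos : ∀ u, 0 < pU u)
    (pVU : V → U → ℝ) (hpVU : ∀ v u, pVU v u = p (v, u) / pU u)
    (ρ : V → U → Matrix n n ℂ) (hρ : ∀ v u, IsDensityMatrix (ρ v u))
    (σ : U → Matrix n n ℂ) (hσ : ∀ u, σ u = ∑ v : V, ((pVU v u : ℝ) : ℂ) • ρ v u)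
    (hσpd : ∀ u, (σ u).PosDef)
    (α : ℝ) (hα : α ∈ Set.Ioo (0 : ℝ) (1/2))
    (L : ℕ) (hL : 1 ≤ L)
    (ν₂ : ℕ) (hν₂ : ν₂ = Finset.univ.sup fun u : U => nEig (σ u))
    (τ : U → (Fin L → V) → Matrix n n ℂ)
    (hτ : ∀ u v, τ u v = ((1 / (L : ℝ) : ℝ) : ℂ) • ∑ ℓ : Fin L, ρ (v ℓ) u)
    (K : ℝ)
    (hK : K = ∑ vu : V × U, p vu *
      (matPow (matPow (σ vu.2) (-α / (2 * (1 + α))) * ρ vu.1 vu.2 *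
        matPow (σ vu.2) (-α / (2 * (1 + α)))) (1 + α)).trace.re) :
    ∑ u : U, pU u * ∑ v : Fin L → V,
        (∏ ℓ : Fin L, pVU (v ℓ) u) * sandwichedRenyi (1 + α) (τ u v) (σ u) ≤
      (1 / (α * Real.log 2)) * ((ν₂ : ℝ) ^ α / (L : ℝ) ^ α) * K := by
  have hterm : ∀ u, ∑ v : Fin L → V,
      (∏ ℓ : Fin L, pVU (v ℓ) u) * sandwichedRenyi (1 + α) (τ u v) (σ u) ≤
      1 / (α * Real.log 2) * (((nEig (σ u) : ℝ) / L) ^ α *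
        ∑ v, pVU v u * (matPow (matPow (σ u) (-α / (2 * (1 + α))) * ρ v u *
          matPow (σ u) (-α / (2 * (1 + α)))) (1 + α)).trace.re) := by
    intro u
    have hq0 : ∀ v, 0 ≤ pVU v u := fun v => by
      rw [hpVU]
      exact div_nonneg (hp0 _) (hpUpos u).le
    have hq : ∑ v, pVU v u = 1 := by
      simp_rw [hpVU]
      rw [← Finset.sum_div, ← hpU, div_self (hpUpos u).ne']
    have hτ' : ∀ v : Fin L → V, τ u v = (1 / (L : ℝ)) • ∑ ℓ, ρ (v ℓ) u := fun v => by
      rw [hτ, Complex.coe_smul]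
    simp_rw [hτ']
    refine sum_prod_sandwichedRenyi_le hq0 hq (fun v => hρ v u) ?_ (hσpd u)
      ⟨hα.1, hα.2.trans (by norm_num)⟩ hL
    simp_rw [hσ u, Complex.coe_smul]
  have hα0 : 0 < α := hα.1
  set C : ℝ := 1 / (α * Real.log 2) with hC
  have hC0 : 0 ≤ C := one_div_nonneg.mpr (mul_nonneg hα0.le (Real.log_nonneg one_le_two))
  have hL0 : (0 : ℝ) ≤ L := Nat.cast_nonneg _
  set Q : V → U → ℝ := fun v u => (matPow (matPow (σ u) (-α / (2 * (1 + α))) * ρ v u *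
    matPow (σ u) (-α / (2 * (1 + α)))) (1 + α)).trace.re with hQ
  have hQ0 : ∀ v u, 0 ≤ pVU v u * Q v u := fun v u => by
    rw [hpVU]
    exact mul_nonneg (div_nonneg (hp0 _) (hpUpos u).le)
      (trace_re_matPow_sandwich_nonneg (hρ v u).1 (hσpd u).posSemidef
        (div_ne_zero (by linarith) (by linarith)) (by linarith))
  have hK' : K = ∑ u, pU u * ∑ v, pVU v u * Q v u := by
    rw [hK, Fintype.sum_prod_type_right]
    refine Finset.sum_congr rfl fun u _ => ?_
    rw [Finset.mul_sum]
    refine Finset.sum_congr rfl fun v _ => ?_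
    rw [hpVU, ← mul_assoc, mul_div_cancel₀ _ (hpUpos u).ne']
  rw [hK', Finset.mul_sum]
  refine Finset.sum_le_sum fun u _ => ?_
  have hν : (nEig (σ u) : ℝ) ≤ ν₂ := by
    rw [hν₂]
    exact_mod_cast Finset.le_sup (f := fun u : U => nEig (σ u)) (Finset.mem_univ u)
  rw [← Real.div_rpow (Nat.cast_nonneg _) hL0, mul_left_comm, mul_assoc C]
  refine mul_le_mul_of_nonneg_left ((hterm u).trans ?_) (hpUpos u).le
  refine mul_le_mul_of_nonneg_left ?_ hC0
  refine mul_le_mul_of_nonneg_right ?_ (Finset.sum_nonneg fun v _ => hQ0 v u)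
  exact Real.rpow_le_rpow (by positivity) (div_le_div_of_nonneg_right hν hL0) hα0.le
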